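/- Let C be a Cayley algebra over F and T := T(C⊗C) the Smirnov algebra with involution. Let χ be the bilinear form on C⊗C determined by χ(a⊗b, c⊗d) = n(a,c)n(b,d). Then the restriction of χ to T is a nondegenerate symmetric bilinear form satisfying χ(x̄,ȳ) = χ(x,y) and χ(xy,z) = χ(x, z ȳ) for all x,y,z ∈ T; moreover, for every abelian group G and every involution preserving G-grading T = ⊕_{g∈G} T_g, one has χ(T_g, T_h) = 0 whenever g + h ≠ 0. -/

import Mathlib

open scoped TensorProduct

noncomputable section

/-- A Hurwitz algebra structure: `n` is a multiplicative quadratic form whose polar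
form is nondegenerate, on a finite-dimensional unital (not necessarily associative)
`F`-algebra `B`. -/
def IsHurwitz (F : Type*) [Field F] {B : Type*} [NonAssocRing B] [Module F B]
    (n : QuadraticForm F B) : Prop :=
  FiniteDimensional F B ∧
    (∀ x : B, (∀ y : B, QuadraticMap.polar n x y = 0) → x = 0) ∧
    (∀ x y : B, n (x * y) = n x * n y)

/-- The standard conjugation `x ↦ n(x,1)·1 - x` of a Hurwitz algebra, as a linear map. -/
def hconj (F : Type*) [Field F] {B : Type*} [NonAssocRing B] [Module F B]
    (n : QuadraticForm F B) : B →ₗ[F] B where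
  toFun x := QuadraticMap.polar n x 1 • (1 : B) - x
  map_add' x y := by
    simp only [QuadraticMap.polar_add_left, add_smul]
    abel
  map_smul' c x := by
    simp [QuadraticMap.polar_smul_left, smul_sub, mul_smul]

/-- The subspace `B₀ = {x ∈ B : x̄ = -x}` of skew elements of a Hurwitz algebra. -/
def skewPart (F : Type*) [Field F] {B : Type*} [NonAssocRing B] [Module F B]
    (n : QuadraticForm F B) : Submodule F B where
  carrier := {x | hconj F n x = -x}
  add_mem' := by
    intro a b ha hb
    simp only [Set.mem_setOf_eq, map_add] at *
    rw [ha, hb]; abel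
  zero_mem' := by simp
  smul_mem' := by
    intro c x hx
    simp only [Set.mem_setOf_eq, map_smul] at *
    rw [hx, smul_neg]

/-- The Smirnov algebra `T(C⊗C) = span{ a⊗a - n(a)·1⊗1 : a ∈ C } ⊆ C ⊗ C`. -/
def smirnovT (F : Type*) [Field F] {C : Type*} [NonAssocRing C] [Module F C]
    (n : QuadraticForm F C) : Submodule F (C ⊗[F] C) :=
  Submodule.span F {x : C ⊗[F] C | ∃ a : C, x = a ⊗ₜ[F] a - n a • ((1 : C) ⊗ₜ[F] (1 : C))}

/-- The involution `σ` of `C ⊗ C`: the tensor product of the standard involutions. -/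
def sigmaT (F : Type*) [Field F] {C : Type*} [NonAssocRing C] [Module F C]
    (n : QuadraticForm F C) : C ⊗[F] C →ₗ[F] C ⊗[F] C :=
  TensorProduct.map (hconj F n) (hconj F n)

/-- An involution preserving `G`-grading of a subalgebra `T` of `A` (with involution `σ`):
a decomposition `T = ⊕_{g ∈ G} T_g` into independent subspaces with `T_g T_h ⊆ T_{g+h}`
and `σ(T_g) ⊆ T_g`. -/
def IsInvolGradingOn (F : Type*) [Field F] {G : Type*} [AddCommGroup G] {A : Type*}
    [NonUnitalNonAssocRing A] [Module F A] (σ : A →ₗ[F] A)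
    (T : Submodule F A) (𝒯 : G → Submodule F A) : Prop :=
  (∀ g : G, 𝒯 g ≤ T) ∧
    (∀ g : G, Disjoint (𝒯 g) (⨆ h : G, ⨆ _ : h ≠ g, 𝒯 h)) ∧
    (⨆ g : G, 𝒯 g) = T ∧
    (∀ ⦃g h : G⦄ ⦃x y : A⦄, x ∈ 𝒯 g → y ∈ 𝒯 h → x * y ∈ 𝒯 (g + h)) ∧
    ∀ (g : G), ∀ x ∈ 𝒯 g, σ x ∈ 𝒯 g

open QuadraticMap

namespace IsHurwitz

variable {F : Type*} [Field F] {B : Type*} [NonAssocRing B] [Module F B]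
  {n : QuadraticForm F B}

theorem map_one [Nontrivial B] (hB : IsHurwitz F n) : n 1 = 1 := by
  have hne : ∃ x, n x ≠ 0 := by
    by_contra! h
    obtain ⟨x, hx⟩ := exists_ne (0 : B)
    exact hx (hB.2.1 x fun y => by simp [polar, h])
  obtain ⟨x, hx⟩ := hne
  have h := hB.2.2 1 x
  rw [one_mul] at h
  exact mul_right_cancel₀ hx (by rw [one_mul]; exact h.symm)

theorem polar_mul_mul_left (hB : IsHurwitz F n) (x y z : B) :
    polar n (y * x) (y * z) = n y * polar n x z := by
  simp only [polar, ← mul_add, hB.2.2]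
  ring

theorem polar_mul_mul_right (hB : IsHurwitz F n) (x y z : B) :
    polar n (x * y) (z * y) = polar n x z * n y := by
  simp only [polar, ← add_mul, hB.2.2]
  ring

theorem polar_mul_add_polar_mul (hB : IsHurwitz F n) (x y z w : B) :
    polar n (x * y) (z * w) + polar n (x * w) (z * y) = polar n x z * polar n y w := by
  have h := hB.polar_mul_mul_right x (y + w) z
  have h₁ := hB.polar_mul_mul_right x y z
  have h₂ := hB.polar_mul_mul_right x w z
  simp only [mul_add, polar_add_left, polar_add_right] at h
  simp only [polar] at *
  linear_combination h - h₁ - h₂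

theorem polar_mul_left (hB : IsHurwitz F n) [SMulCommClass F B B] (x y z : B) :
    polar n (x * y) z = polar n x (z * hconj F n y) := by
  have h := hB.polar_mul_add_polar_mul x y z 1
  simp only [mul_one] at h
  simp only [hconj, LinearMap.coe_mk, AddHom.coe_mk, mul_sub, mul_smul_comm, mul_one,
    polar_sub_right, polar_smul_right, smul_eq_mul]
  linear_combination h

theorem polar_mul_left' (hB : IsHurwitz F n) [IsScalarTower F B B] (x y z : B) :
    polar n (x * y) z = polar n y (hconj F n x * z) := by
  have h := hB.polar_mul_add_polar_mul x y 1 z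
  simp only [one_mul] at h
  simp only [hconj, LinearMap.coe_mk, AddHom.coe_mk, sub_mul, smul_mul_assoc, one_mul,
    polar_sub_right, polar_smul_right, smul_eq_mul]
  rw [polar_comm n (x * z) y] at h
  linear_combination h

theorem polar_one_one [Nontrivial B] (hB : IsHurwitz F n) : polar n 1 1 = 2 := by
  rw [polar_self, hB.map_one]; simp

theorem polar_hconj_hconj [Nontrivial B] (hB : IsHurwitz F n) (x y : B) :
    polar n (hconj F n x) (hconj F n y) = polar n x y := by
  simp only [hconj, LinearMap.coe_mk, AddHom.coe_mk, polar_sub_right, polar_smul_right,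
    polar_sub_left, polar_smul_left, smul_eq_mul, hB.polar_one_one, polar_comm n 1 y]
  ring

theorem polar_mul_self_one (hB : IsHurwitz F n) [SMulCommClass F B B] (a : B) :
    polar n (a * a) 1 = polar n a 1 * polar n a 1 - 2 * n a := by
  rw [hB.polar_mul_left, one_mul]
  simp [hconj, polar_sub_right, polar_smul_right]

theorem polarBilin_injective (hB : IsHurwitz F n) :
    Function.Injective (n.polarBilin : B →ₗ[F] B →ₗ[F] F) := by
  rw [injective_iff_map_eq_zero]
  exact fun x hx => hB.2.1 x fun y => by simpa using LinearMap.congr_fun hx y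

/-- The isomorphism of a Hurwitz algebra with its dual given by the polar form of the norm. -/
def toDual (hB : IsHurwitz F n) : B ≃ₗ[F] Module.Dual F B :=
  haveI := hB.1
  LinearEquiv.ofInjectiveOfFinrankEq (n.polarBilin : B →ₗ[F] B →ₗ[F] F) hB.polarBilin_injective
    Subspace.dual_finrank_eq.symm

theorem toDual_apply (hB : IsHurwitz F n) (x y : B) : hB.toDual x y = polar n x y := rfl

theorem trace_mulLeft [SMulCommClass F B B] [IsScalarTower F B B]
    (hB : IsHurwitz F n) (a : B) :
    2 * LinearMap.trace F B (LinearMap.mulLeft F a) = Module.finrank F B * polar n a 1 := by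
  have := hB.1
  have hconj_left : LinearMap.mulLeft F (hconj F n a) =
      polar n a 1 • LinearMap.id - LinearMap.mulLeft F a := by
    ext x
    simp [hconj, sub_mul]
  have hadj : hB.toDual.conj (LinearMap.mulLeft F (hconj F n a)) =
      Module.Dual.transpose (R := F) (LinearMap.mulLeft F a) := by
    ext f y
    obtain ⟨x, rfl⟩ := hB.toDual.surjective f
    have h := hB.polar_mul_left' a y x
    simpa [LinearEquiv.conj_apply, toDual_apply, Module.Dual.transpose_apply,
      polar_comm n x, polar_comm n _ y] using h.symm
  have h := congrArg (LinearMap.trace F _) hadj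
  rw [LinearMap.trace_conj', LinearMap.trace_transpose', hconj_left] at h
  simp only [map_sub, map_smul, LinearMap.trace_id, smul_eq_mul] at h
  linear_combination -h

end IsHurwitz

section Smirnov

variable {F : Type*} [Field F] {C : Type*} [NonAssocRing C] [Module F C]
  {n : QuadraticForm F C}

theorem smirnovT_induction {P : (x : C ⊗[F] C) → x ∈ smirnovT F n → Prop}
    (gen : ∀ (a : C) (h : a ⊗ₜ[F] a - n a • ((1 : C) ⊗ₜ[F] (1 : C)) ∈ smirnovT F n), P _ h)
    (zero : P 0 (zero_mem _)) (add : ∀ x y hx hy, P x hx → P y hy → P (x + y) (add_mem hx hy))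
    (smul : ∀ (c : F) x hx, P x hx → P (c • x) (Submodule.smul_mem _ c hx))
    {x : C ⊗[F] C} (hx : x ∈ smirnovT F n) : P x hx := by
  refine Submodule.span_induction (p := P) ?_ zero add smul hx
  rintro _ ⟨a, rfl⟩
  exact gen a _

theorem tmul_self_sub_mem_smirnovT (a : C) :
    a ⊗ₜ[F] a - n a • ((1 : C) ⊗ₜ[F] (1 : C)) ∈ smirnovT F n :=
  Submodule.subset_span ⟨a, rfl⟩

variable (F n) in
/-- The contraction `C ⊗ C → End C`, sending `u ⊗ v` to `w ↦ n(u, w) v`. -/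
def normContraction : C ⊗[F] C →ₗ[F] Module.End F C :=
  dualTensorHom F C C ∘ₗ TensorProduct.map n.polarBilin LinearMap.id

theorem normContraction_tmul (u v w : C) :
    normContraction F n (u ⊗ₜ v) w = polar n u w • v := by
  simp [normContraction]

theorem IsHurwitz.normContraction_injective (hC : IsHurwitz F n) :
    Function.Injective (normContraction F n) := by
  have := hC.1
  have h : normContraction F n = (TensorProduct.congr hC.toDual (LinearEquiv.refl F C) ≪≫ₗ
      dualTensorHomEquiv F C C).toLinearMap := by
    ext u v w
    simp [normContraction, hC.toDual_apply]
  rw [h]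
  exact LinearEquiv.injective _

theorem IsHurwitz.trace_normContraction_tmul (hC : IsHurwitz F n) (u v : C) :
    LinearMap.trace F C (normContraction F n (u ⊗ₜ v)) = polar n u v := by
  have := hC.1
  simp [normContraction]

theorem IsHurwitz.trace_normContraction [Nontrivial C] (hC : IsHurwitz F n) {x : C ⊗[F] C}
    (hx : x ∈ smirnovT F n) : LinearMap.trace F C (normContraction F n x) = 0 := by
  induction hx using smirnovT_induction with
  | zero => simp
  | add x y _ _ hx hy => simp [hx, hy]
  | smul c x _ hx => simp [hx]
  | gen a _ =>
    rw [map_sub, map_smul, map_sub, map_smul, hC.trace_normContraction_tmul,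
      hC.trace_normContraction_tmul, hC.polar_one_one, polar_self]
    simp [mul_comm]

variable (F n) in
/-- The map `C ⊗ C → C` sending `u ⊗ v` to `n(v, 1) (u - ū)`. -/
def skewProjection : C ⊗[F] C →ₗ[F] C :=
  TensorProduct.rid F C ∘ₗ
    TensorProduct.map (LinearMap.id - hconj F n) (n.polarBilin.flip 1)

theorem skewProjection_tmul (u v : C) :
    skewProjection F n (u ⊗ₜ v) = polar n v 1 • (u - hconj F n u) := by
  simp [skewProjection]

variable (F n) in
/-- The map `C → C ⊗ C` sending `c` to `s ⊗ 1 + 1 ⊗ s`, where `s = c - c̄`. -/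
def skewInclusion : C →ₗ[F] C ⊗[F] C :=
  ((TensorProduct.mk F C C).flip 1 + TensorProduct.mk F C C 1) ∘ₗ
    (LinearMap.id - hconj F n)

theorem skewInclusion_apply (c : C) :
    skewInclusion F n c = (c - hconj F n c) ⊗ₜ 1 + 1 ⊗ₜ (c - hconj F n c) := by
  simp [skewInclusion, TensorProduct.sub_tmul, TensorProduct.tmul_sub]

theorem hconj_apply (c : C) : hconj F n c = polar n c 1 • (1 : C) - c := rfl

theorem IsHurwitz.skewInclusion_mem [Nontrivial C] (hC : IsHurwitz F n) (c : C) :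
    skewInclusion F n c ∈ smirnovT F n := by
  set s := c - hconj F n c with hs
  have hs1 : polar n 1 s = 0 := by
    rw [polar_comm, hs, hconj_apply]
    simp only [polar_sub_left, polar_smul_left, hC.polar_one_one, smul_eq_mul]
    ring
  have hn : n (1 + s) = 1 + n s := by
    rw [QuadraticMap.map_add n, hs1, hC.map_one, add_zero]
  have h := sub_mem (tmul_self_sub_mem_smirnovT (n := n) (1 + s))
    (tmul_self_sub_mem_smirnovT (n := n) s)
  convert h using 1
  rw [skewInclusion_apply, ← hs, hn]
  simp only [TensorProduct.add_tmul, TensorProduct.tmul_add, add_smul, one_smul]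
  abel

theorem IsHurwitz.skewInclusion_skewProjection [Nontrivial C] (hC : IsHurwitz F n)
    {x : C ⊗[F] C} (hx : x ∈ smirnovT F n) :
    skewInclusion F n (skewProjection F n x) = (4 : F) • (x - sigmaT F n x) := by
  induction hx using smirnovT_induction with
  | zero => simp
  | add x y _ _ hx hy => simp only [map_add, hx, hy]; module
  | smul c x _ hx => simp only [map_smul, hx]; module
  | gen a _ =>
    have h1 : hconj F n (1 : C) = 1 := by
      rw [hconj_apply, hC.polar_one_one, two_smul, add_sub_cancel_right]
    have h2 : hconj F n (hconj F n a) = a := by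
      conv_lhs => rw [hconj_apply a, map_sub, map_smul, h1, hconj_apply, sub_sub_cancel]
    have h3 : polar n a 1 • (1 : C) = a + hconj F n a := by rw [hconj_apply]; abel
    have h4 (y : C) : polar n a 1 • (y ⊗ₜ[F] (1 : C) + (1 : C) ⊗ₜ[F] y) =
        y ⊗ₜ (a + hconj F n a) + (a + hconj F n a) ⊗ₜ y := by
      rw [smul_add, ← TensorProduct.tmul_smul, h3, TensorProduct.smul_tmul', h3]
    simp only [map_sub, map_smul, skewProjection_tmul, h1, sub_self, smul_zero, sub_zero,
      skewInclusion_apply, h2, sigmaT, TensorProduct.map_tmul]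
    rw [smul_sub, h4, h4]
    simp only [TensorProduct.tmul_add, TensorProduct.add_tmul, TensorProduct.tmul_sub,
      TensorProduct.sub_tmul]
    module

variable [SMulCommClass F C C] [IsScalarTower F C C]

theorem IsHurwitz.trace_skewProjection_mul [Nontrivial C] (hC : IsHurwitz F n)
    (hF : (2 : F) ≠ 0) (hdim : Module.finrank F C = 8) (a : C) :
    LinearMap.trace F C (skewProjection F n ∘ₗ LinearMap.mulLeft F (a ⊗ₜ[F] a) ∘ₗ
      skewInclusion F n) = 16 * polar n a 1 ^ 2 - 8 * n a := by
  have := hC.1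
  have htr : LinearMap.trace F C (LinearMap.mulLeft F a) = 4 * polar n a 1 := by
    refine mul_left_cancel₀ hF ?_
    rw [hC.trace_mulLeft, hdim]
    push_cast
    ring
  have h : skewProjection F n ∘ₗ LinearMap.mulLeft F (a ⊗ₜ[F] a) ∘ₗ skewInclusion F n =
      (4 * polar n a 1) • LinearMap.mulLeft F a
        - (2 * polar n a 1) • (n.polarBilin.flip 1 : C →ₗ[F] F).smulRight a
        - (polar n a 1) • ((2 : F) • (n.polarBilin.flip 1 ∘ₗ LinearMap.mulLeft F a)
          - polar n a 1 • (n.polarBilin.flip 1)).smulRight (1 : C)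
        + ((2 : F) • (n.polarBilin.flip 1 ∘ₗ LinearMap.mulLeft F a)
          - polar n a 1 • (n.polarBilin.flip 1)).smulRight ((2 : F) • a - polar n a 1 • (1 : C)) := by
    ext c
    simp only [LinearMap.comp_apply, skewInclusion_apply, LinearMap.mulLeft_apply,
      Algebra.TensorProduct.tmul_mul_tmul, mul_one, map_add, skewProjection_tmul, hconj_apply,
      mul_sub, mul_smul_comm, polar_sub_left, polar_smul_left, smul_eq_mul,
      LinearMap.add_apply, LinearMap.sub_apply, LinearMap.smul_apply, LinearMap.smulRight_apply,
      LinearMap.flip_apply, polarBilin_apply_apply]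
    module
  rw [h]
  simp only [map_add, map_sub, map_smul, LinearMap.trace_smulRight, htr, smul_eq_mul,
    LinearMap.comp_apply, LinearMap.mulLeft_apply, LinearMap.sub_apply, LinearMap.smul_apply,
    LinearMap.flip_apply, polarBilin_apply_apply, mul_one, hC.polar_one_one,
    hC.polar_mul_self_one]
  ring

theorem IsHurwitz.trace_skewProjection_mul_of_mem [Nontrivial C] (hC : IsHurwitz F n)
    (hF : (2 : F) ≠ 0) (hdim : Module.finrank F C = 8)
    {χ : C ⊗[F] C →ₗ[F] C ⊗[F] C →ₗ[F] F}
    (hχ : ∀ a b c d : C, χ (a ⊗ₜ[F] b) (c ⊗ₜ[F] d) = polar n a c * polar n b d)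
    {w : C ⊗[F] C} (hw : w ∈ smirnovT F n) :
    LinearMap.trace F C (skewProjection F n ∘ₗ LinearMap.mulLeft F w ∘ₗ skewInclusion F n) =
      16 * χ 1 w := by
  let Θ : C ⊗[F] C →ₗ[F] F := LinearMap.trace F C ∘ₗ
    (LinearMap.lcomp F _ (skewInclusion F n)) ∘ₗ
    (LinearMap.llcomp F _ _ _ (skewProjection F n)) ∘ₗ LinearMap.mul F (C ⊗[F] C)
  change Θ w = _
  induction hw using smirnovT_induction with
  | zero => simp
  | add x y _ _ hx hy => simp only [map_add, hx, hy]; ring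
  | smul c x _ hx => simp only [map_smul, hx, smul_eq_mul]; ring
  | gen a _ =>
    have hΘ : ∀ a : C, Θ (a ⊗ₜ a) = 16 * polar n a 1 ^ 2 - 8 * n a :=
      fun a => hC.trace_skewProjection_mul hF hdim a
    simp only [map_sub, map_smul, hΘ, Algebra.TensorProduct.one_def, hχ, hC.polar_one_one,
      hC.map_one, polar_comm n 1 a, smul_eq_mul]
    ring

end Smirnov

theorem LinearMap.trace_eq_zero_of_iSupIndep {F V G : Type*} [Field F] [AddCommGroup V]
    [Module F V] [FiniteDimensional F V] [AddCommGroup G] {𝒯 : G → Submodule F V}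
    (hind : iSupIndep 𝒯) (htop : ⨆ g, 𝒯 g = ⊤) {k : G} (hk : k ≠ 0) {f : Module.End F V}
    (hf : ∀ g, ∀ x ∈ 𝒯 g, f x ∈ 𝒯 (k + g)) : LinearMap.trace F V f = 0 := by
  classical
  exact LinearMap.trace_eq_zero_of_mapsTo_ne
    (DirectSum.isInternal_submodule_of_iSupIndep_of_iSup_eq_top hind htop) (fun g => k + g)
    (fun g => by simpa using hk) hf

theorem iSupIndep.submoduleOf {F V ι : Type*} [Ring F] [AddCommGroup V] [Module F V]
    {𝒯 : ι → Submodule F V} (hind : iSupIndep 𝒯) {T : Submodule F V} :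
    iSupIndep fun i => (𝒯 i).submoduleOf T := by
  intro i
  rw [Submodule.disjoint_def]
  intro x hx hx'
  refine Subtype.ext ((Submodule.disjoint_def.1 (hind i)) x hx ?_)
  have h : Submodule.map T.subtype (⨆ j, ⨆ _ : j ≠ i, (𝒯 j).submoduleOf T) ≤
      ⨆ j, ⨆ _ : j ≠ i, 𝒯 j := by
    simp only [Submodule.map_iSup]
    exact iSup₂_mono fun j _ => Submodule.map_comap_le _ _
  exact h (Submodule.mem_map_of_mem hx')

theorem Submodule.iSup_submoduleOf_eq_top {F V ι : Type*} [Ring F] [AddCommGroup V] [Module F V]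
    {𝒯 : ι → Submodule F V} {T : Submodule F V} (h : ⨆ i, 𝒯 i = T) :
    ⨆ i, (𝒯 i).submoduleOf T = ⊤ := by
  have hle : ∀ i, 𝒯 i ≤ T := fun i => h ▸ le_iSup 𝒯 i
  apply Submodule.map_injective_of_injective T.subtype_injective
  simp only [Submodule.map_iSup, Submodule.submoduleOf, Submodule.map_comap_subtype,
    Submodule.map_subtype_top, inf_of_le_right (hle _), h]

section Grading

variable {F : Type*} [Field F] {A : Type*} [NonUnitalNonAssocRing A] [Module F A]
  {G : Type*} [AddCommGroup G] {σ : A →ₗ[F] A} {T : Submodule F A} {𝒯 : G → Submodule F A}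

theorem IsInvolGradingOn.mul_mem (h : IsInvolGradingOn F σ T 𝒯) {k : G} {w x : A}
    (hw : w ∈ 𝒯 k) (hx : x ∈ T) : w * x ∈ T := by
  rw [← h.2.2.1] at hx
  induction hx using Submodule.iSup_induction' with
  | mem g x hx => exact h.1 _ (h.2.2.2.1 hw hx)
  | zero => simp
  | add x y _ _ hx hy => rw [mul_add]; exact add_mem hx hy

/-- On a graded algebra with involution, left multiplication by a homogeneous element of nonzero
degree composed with the projection onto the skew part is traceless. -/
theorem IsInvolGradingOn.trace_eq_zero [FiniteDimensional F A]
    (h : IsInvolGradingOn F σ T 𝒯) {k : G} (hk : k ≠ 0)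
    {w : A} (hw : w ∈ 𝒯 k) (c : F) {f : Module.End F T}
    (hf : ∀ x : T, (f x : A) = w * (c • ((x : A) - σ x))) : LinearMap.trace F T f = 0 := by
  refine LinearMap.trace_eq_zero_of_iSupIndep (iSupIndep.submoduleOf h.2.1)
    (Submodule.iSup_submoduleOf_eq_top h.2.2.1) hk fun g x hx => ?_
  change (f x : A) ∈ 𝒯 (k + g)
  rw [hf]
  exact h.2.2.2.1 hw (Submodule.smul_mem _ _ (sub_mem hx (h.2.2.2.2 g _ hx)))

end Grading

section Smirnov

variable {F : Type*} [Field F] {C : Type*} [NonAssocRing C] [Module F C]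
  {n : QuadraticForm F C} {χ : C ⊗[F] C →ₗ[F] C ⊗[F] C →ₗ[F] F}

theorem tensorNorm_comm
    (hχ : ∀ a b c d : C, χ (a ⊗ₜ[F] b) (c ⊗ₜ[F] d) = polar n a c * polar n b d)
    (x y : C ⊗[F] C) : χ x y = χ y x := by
  have h : χ = χ.flip := by
    ext a b c d
    simp [hχ, polar_comm n a, polar_comm n b]
  exact LinearMap.congr_fun₂ h x y

theorem IsHurwitz.tensorNorm_sigmaT [Nontrivial C] (hC : IsHurwitz F n)
    (hχ : ∀ a b c d : C, χ (a ⊗ₜ[F] b) (c ⊗ₜ[F] d) = polar n a c * polar n b d)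
    (x y : C ⊗[F] C) : χ (sigmaT F n x) (sigmaT F n y) = χ x y := by
  have h : χ.compl₁₂ (sigmaT F n) (sigmaT F n) = χ := by
    ext a b c d
    simp [hχ, sigmaT, hC.polar_hconj_hconj]
  exact LinearMap.congr_fun₂ h x y

theorem IsHurwitz.tensorNorm_mul_left [SMulCommClass F C C] [IsScalarTower F C C]
    (hC : IsHurwitz F n)
    (hχ : ∀ a b c d : C, χ (a ⊗ₜ[F] b) (c ⊗ₜ[F] d) = polar n a c * polar n b d)
    (x y z : C ⊗[F] C) : χ (x * y) z = χ x (z * sigmaT F n y) := by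
  induction x with
  | zero => simp
  | add x x' hx hx' => simp only [add_mul, map_add, LinearMap.add_apply, hx, hx']
  | tmul a b =>
    induction y with
    | zero => simp
    | add y y' hy hy' => simp only [mul_add, map_add, LinearMap.add_apply, hy, hy']
    | tmul c d =>
      induction z with
      | zero => simp
      | add z z' hz hz' => simp only [add_mul, map_add, hz, hz']
      | tmul u v => simp [sigmaT, hχ, hC.polar_mul_left]

theorem tensorNorm_tmul_right
    (hχ : ∀ a b c d : C, χ (a ⊗ₜ[F] b) (c ⊗ₜ[F] d) = polar n a c * polar n b d)
    (x : C ⊗[F] C) (u v : C) : χ x (u ⊗ₜ v) = polar n (normContraction F n x u) v := by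
  induction x with
  | zero => simp
  | add x y hx hy => simp [hx, hy, polar_add_left]
  | tmul a b => simp [hχ, normContraction_tmul, polar_smul_left]

theorem tensorNorm_tmul_comm
    (hχ : ∀ a b c d : C, χ (a ⊗ₜ[F] b) (c ⊗ₜ[F] d) = polar n a c * polar n b d)
    {x : C ⊗[F] C} (hx : x ∈ smirnovT F n) (u v : C) : χ x (u ⊗ₜ v) = χ x (v ⊗ₜ u) := by
  induction hx using smirnovT_induction with
  | zero => simp
  | add x y _ _ hx hy => simp [hx, hy]
  | smul c x _ hx => simp [hx]
  | gen a _ => simp [hχ, mul_comm]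

theorem IsHurwitz.tensorNorm_nondegenerate [Nontrivial C] (hC : IsHurwitz F n)
    (hF : (2 : F) ≠ 0) (hdim : Module.finrank F C = 8)
    (hχ : ∀ a b c d : C, χ (a ⊗ₜ[F] b) (c ⊗ₜ[F] d) = polar n a c * polar n b d)
    {x : C ⊗[F] C} (hx : x ∈ smirnovT F n) (h : ∀ y ∈ smirnovT F n, χ x y = 0) : x = 0 := by
  have := hC.1
  have hdiag : ∀ a : C, χ x (a ⊗ₜ a) = n a * χ x (1 ⊗ₜ 1) := fun a => by
    have := h _ (tmul_self_sub_mem_smirnovT a)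
    rwa [map_sub, map_smul, smul_eq_mul, sub_eq_zero] at this
  have hpolar : ∀ u v : C, 2 * χ x (u ⊗ₜ v) = polar n u v * χ x (1 ⊗ₜ 1) := fun u v => by
    have h₁ := hdiag (u + v)
    rw [TensorProduct.add_tmul, TensorProduct.tmul_add, TensorProduct.tmul_add, map_add, map_add,
      map_add, hdiag u, hdiag v, tensorNorm_tmul_comm hχ hx v u] at h₁
    simp only [polar]
    linear_combination h₁
  have hcontr : (2 : F) • normContraction F n x = χ x (1 ⊗ₜ 1) • LinearMap.id := by
    ext u
    refine sub_eq_zero.1 (hC.2.1 _ fun v => ?_)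
    have h₁ := hpolar u v
    rw [tensorNorm_tmul_right hχ] at h₁
    simp only [LinearMap.smul_apply, LinearMap.id_apply, polar_sub_left, polar_smul_left,
      smul_eq_mul]
    linear_combination h₁
  have h8 : (8 : F) ≠ 0 := by
    have : (8 : F) = 2 ^ 3 := by norm_num
    rw [this]
    exact pow_ne_zero 3 hF
  have hzero : χ x (1 ⊗ₜ 1) = 0 := by
    have h₁ := congrArg (LinearMap.trace F C) hcontr
    rw [map_smul, hC.trace_normContraction hx, map_smul, LinearMap.trace_id, hdim] at h₁
    simpa [h8] using h₁
  rw [hzero, zero_smul] at hcontr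
  exact (map_eq_zero_iff _ hC.normContraction_injective).1 ((smul_eq_zero_iff_right hF).1 hcontr)

variable [SMulCommClass F C C] [IsScalarTower F C C]

theorem IsHurwitz.tensorNorm_one_eq_zero [Nontrivial C] (hC : IsHurwitz F n)
    (hF : (2 : F) ≠ 0) (hdim : Module.finrank F C = 8)
    (hχ : ∀ a b c d : C, χ (a ⊗ₜ[F] b) (c ⊗ₜ[F] d) = polar n a c * polar n b d)
    {G : Type*} [AddCommGroup G] {𝒯 : G → Submodule F (C ⊗[F] C)}
    (h𝒯 : IsInvolGradingOn F (sigmaT F n) (smirnovT F n) 𝒯) {k : G} (hk : k ≠ 0)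
    {w : C ⊗[F] C} (hw : w ∈ 𝒯 k) : χ 1 w = 0 := by
  have := hC.1
  let D : C →ₗ[F] smirnovT F n :=
    (LinearMap.mulLeft F w ∘ₗ skewInclusion F n).codRestrict (smirnovT F n)
      fun c => h𝒯.mul_mem hw (hC.skewInclusion_mem c)
  let P : smirnovT F n →ₗ[F] C := skewProjection F n ∘ₗ (smirnovT F n).subtype
  have h₁ : LinearMap.trace F _ (P ∘ₗ D) = 16 * χ 1 w :=
    hC.trace_skewProjection_mul_of_mem hF hdim hχ (h𝒯.1 k hw)
  have h₂ : LinearMap.trace F _ (D ∘ₗ P) = 0 :=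
    h𝒯.trace_eq_zero hk hw 4 fun x => by
      rw [← hC.skewInclusion_skewProjection x.2]
      rfl
  rw [LinearMap.trace_comp_comm', h₂] at h₁
  have h16 : (16 : F) ≠ 0 := by
    have : (16 : F) = 2 ^ 4 := by norm_num
    rw [this]
    exact pow_ne_zero 4 hF
  exact (mul_eq_zero.1 h₁.symm).resolve_left h16

end Smirnov

/-- Let `C` be a Cayley algebra over a field `F` of characteristic `≠ 2`
and `T = T(C⊗C)` the Smirnov algebra with involution `σ`.  Let `χ` be the bilinear form on
`C ⊗ C` determined by `χ(a⊗b, c⊗d) = n(a,c)·n(b,d)`.  Then the restriction of `χ` to `T` is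
a nondegenerate symmetric bilinear form which is invariant (`χ(σx, σy) = χ(x,y)` and
`χ(xy, z) = χ(x, z·σy)`), and for every involution preserving grading of `T` by an abelian
group `G`, `χ(T_g, T_h) = 0` whenever `g + h ≠ 0`. -/
theorem smirnov_trace_form_properties (F : Type*) [Field F] (hF : (2 : F) ≠ 0)
    (C : Type*) [NonAssocRing C] [Module F C] [SMulCommClass F C C] [IsScalarTower F C C]
    (n : QuadraticForm F C) (hC : IsHurwitz F n) (hdim : Module.finrank F C = 8)
    (χ : C ⊗[F] C →ₗ[F] C ⊗[F] C →ₗ[F] F)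
    (hχ : ∀ a b c d : C, χ (a ⊗ₜ[F] b) (c ⊗ₜ[F] d) =
      QuadraticMap.polar n a c * QuadraticMap.polar n b d) :
    -- symmetric on `T`:
    (∀ x ∈ smirnovT F n, ∀ y ∈ smirnovT F n, χ x y = χ y x) ∧
    -- nondegenerate on `T`:
    (∀ x ∈ smirnovT F n, (∀ y ∈ smirnovT F n, χ x y = 0) → x = 0) ∧
    -- invariant under the involution:
    (∀ x ∈ smirnovT F n, ∀ y ∈ smirnovT F n,
      χ (sigmaT F n x) (sigmaT F n y) = χ x y) ∧
    -- associativity-type invariance: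
    (∀ x ∈ smirnovT F n, ∀ y ∈ smirnovT F n, ∀ z ∈ smirnovT F n,
      χ (x * y) z = χ x (z * sigmaT F n y)) ∧
    -- homogeneity for every involution preserving grading:
    (∀ (G : Type*) [AddCommGroup G], ∀ 𝒯 : G → Submodule F (C ⊗[F] C),
      IsInvolGradingOn F (sigmaT F n) (smirnovT F n) 𝒯 →
      ∀ g h : G, g + h ≠ 0 → ∀ x ∈ 𝒯 g, ∀ y ∈ 𝒯 h, χ x y = 0) := by
  have : Nontrivial C := Module.nontrivial_of_finrank_pos (R := F) (by omega)
  refine ⟨fun x _ y _ => tensorNorm_comm hχ x y,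
    fun x hx h => hC.tensorNorm_nondegenerate hF hdim hχ hx h,
    fun x _ y _ => hC.tensorNorm_sigmaT hχ x y,
    fun x _ y _ z _ => hC.tensorNorm_mul_left hχ x y z, ?_⟩
  intro G _ 𝒯 h𝒯 g h hgh x hx y hy
  rw [← one_mul x, hC.tensorNorm_mul_left hχ]
  refine hC.tensorNorm_one_eq_zero hF hdim hχ h𝒯 hgh ?_
  rw [add_comm]
  exact h𝒯.2.2.2.1 hy (h𝒯.2.2.2.2 g x hx)
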